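/- Let p ≥ 3 be a natural number and define F₁₁ as in the context. Then for every real t ≥ 0, ∑_{m=1}^{p−1} ∑_{l=1}^{p−1} [ F₁₁(p−m, p−l; t) + ∑_{a=2}^∞ F₁₁(pa−m, p−l; t) ] > 0. -/

import Mathlib

noncomputable def c (p k : ℕ) : ℝ :=
  if k = p then 1 / (p : ℝ)
  else (2 * (p : ℝ)^2 * Real.sin (Real.pi * k / p)) /
       (Real.pi * (k : ℝ) * ((p : ℝ)^2 - (k : ℝ)^2))

noncomputable def d (p k : ℕ) : ℝ :=
  if k = p ∨ k = 2 * p then 1 / (p : ℝ)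
  else (6 * (p : ℝ)^2 * (k : ℝ) * Real.sin (Real.pi * k / p)) /
       (Real.pi * ((p : ℝ)^2 - (k : ℝ)^2) * (4 * (p : ℝ)^2 - (k : ℝ)^2))

noncomputable def F11 (p m l : ℕ) (t : ℝ) : ℝ :=
  c p m * d p l * c p (m + l) *
    Real.exp (-2 * ((m : ℝ)^2 + (l : ℝ)^2 + (m : ℝ) * (l : ℝ)) * t)

noncomputable def F12 (p m l : ℕ) (t : ℝ) : ℝ :=
  c p m * c p l * d p (m + l) *
    Real.exp (-2 * ((m : ℝ)^2 + (l : ℝ)^2 + (m : ℝ) * (l : ℝ)) * t)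

/-- Translating the argument by a multiple of `p` only changes the sine in `c` by a sign. -/
lemma abs_c_add_mul {p k b : ℕ} (hp : 0 < p) (hk : 0 < k) (hb : 0 < b) :
    |c p (k + p * b)| = 2 * (p : ℝ) ^ 2 * |Real.sin (Real.pi * k / p)| /
      (Real.pi * (k + p * b) * ((k + p * b : ℝ) ^ 2 - (p : ℝ) ^ 2)) := by
  have hpR : (0 : ℝ) < p := by exact_mod_cast hp
  have hkR : (0 : ℝ) < k := by exact_mod_cast hk
  have hbR : (1 : ℝ) ≤ b := by exact_mod_cast hb
  have hpb : (p : ℝ) ≤ p * b := le_mul_of_one_le_right hpR.le hbR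
  have hne : k + p * b ≠ p := by
    have : p ≤ p * b := Nat.le_mul_of_pos_right p hb
    omega
  have harg : Real.pi * (k + p * b) / p = Real.pi * k / p + b * Real.pi := by
    field_simp
  have hsin : |Real.sin (Real.pi * (k + p * b) / p)| = |Real.sin (Real.pi * k / p)| := by
    rw [harg, Real.sin_add_nat_mul_pi, abs_mul, abs_pow, abs_neg, abs_one, one_pow, one_mul]
  have hden : (p : ℝ) ^ 2 - (k + p * b : ℝ) ^ 2 < 0 := by nlinarith
  have hy : (0 : ℝ) < k + p * b := by linarith
  unfold c
  rw [if_neg hne]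
  push_cast
  rw [abs_div, abs_mul, hsin, abs_mul (Real.pi * _), abs_of_neg hden, abs_of_pos (mul_pos Real.pi_pos hy),
    abs_of_nonneg (by positivity : (0 : ℝ) ≤ 2 * (p : ℝ) ^ 2), neg_sub]

lemma sin_pi_mul_div_pos {p k : ℕ} (hk : 0 < k) (hkp : k < p) :
    0 < Real.sin (Real.pi * k / p) := by
  have hkR : (0 : ℝ) < k := by exact_mod_cast hk
  have hkpR : (k : ℝ) < p := by exact_mod_cast hkp
  have hpR : (0 : ℝ) < p := hkR.trans hkpR
  apply Real.sin_pos_of_pos_of_lt_pi (by positivity)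
  rw [div_lt_iff₀ hpR]
  exact mul_lt_mul_of_pos_left hkpR Real.pi_pos

lemma c_pos {p k : ℕ} (hk : 0 < k) (hk2 : k < 2 * p) : 0 < c p k := by
  have hkR : (0 : ℝ) < k := by exact_mod_cast hk
  have hpR : (0 : ℝ) < p := by
    have : 0 < p := by omega
    exact_mod_cast this
  unfold c
  rcases lt_trichotomy k p with h | h | h
  · rw [if_neg h.ne]
    have hkpR : (k : ℝ) < p := by exact_mod_cast h
    have hs := sin_pi_mul_div_pos hk h
    have hden : 0 < (p : ℝ) ^ 2 - (k : ℝ) ^ 2 := by nlinarith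
    positivity
  · rw [if_pos h]
    positivity
  · rw [if_neg h.ne']
    obtain ⟨j, rfl⟩ := Nat.exists_eq_add_of_lt h
    have hs := sin_pi_mul_div_pos (p := p) (k := j + 1) (by omega) (by omega)
    have hpk : (p : ℝ) < (p + j + 1 : ℕ) := by exact_mod_cast h
    have hden : (p : ℝ) ^ 2 - ((p + j + 1 : ℕ) : ℝ) ^ 2 < 0 := by nlinarith
    have harg : Real.pi * (p + j + 1 : ℕ) / p = Real.pi * (j + 1 : ℕ) / p + Real.pi := by
      push_cast
      field_simp
      ring
    rw [harg, Real.sin_add_pi]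
    apply div_pos_of_neg_of_neg
    · rw [mul_neg, neg_lt_zero]
      positivity
    · exact mul_neg_of_pos_of_neg (by positivity) hden

lemma d_pos {p k : ℕ} (hk : 0 < k) (hkp : k < p) : 0 < d p k := by
  have hkR : (0 : ℝ) < k := by exact_mod_cast hk
  have hkpR : (k : ℝ) < p := by exact_mod_cast hkp
  have hpR : (0 : ℝ) < p := hkR.trans hkpR
  have hs := sin_pi_mul_div_pos hk hkp
  have h1 : 0 < (p : ℝ) ^ 2 - (k : ℝ) ^ 2 := by nlinarith
  have h2 : 0 < 4 * (p : ℝ) ^ 2 - (k : ℝ) ^ 2 := by nlinarith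
  unfold d
  rw [if_neg (by omega)]
  positivity

lemma abs_c_add_mul_le {p k b : ℕ} (hk : 0 < k) (hk2 : k < 2 * p) (hb : 0 < b) :
    |c p (k + p * b)| ≤ c p k := by
  have hp : 0 < p := by omega
  have hpR : (0 : ℝ) < p := by exact_mod_cast hp
  have hkR : (0 : ℝ) < k := by exact_mod_cast hk
  have hbR : (1 : ℝ) ≤ b := by exact_mod_cast hb
  have hpb : (p : ℝ) ≤ p * b := le_mul_of_one_le_right hpR.le hbR
  rw [abs_c_add_mul hp hk hb, ← abs_of_pos (c_pos hk hk2)]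
  unfold c
  split_ifs with h
  · subst h
    rw [mul_div_cancel_right₀ _ hkR.ne', Real.sin_pi]
    simp
  · have hne : (p : ℝ) ^ 2 - (k : ℝ) ^ 2 ≠ 0 := by
      intro h0
      apply h
      have : (k : ℝ) = p := by
        rw [← sq_eq_sq₀ hkR.le hpR.le]
        linarith
      exact_mod_cast this
    rw [abs_div, abs_mul (2 * (p : ℝ) ^ 2), abs_of_pos (by positivity : 0 < 2 * (p : ℝ) ^ 2),
      abs_mul (Real.pi * k), abs_of_pos (mul_pos Real.pi_pos hkR)]
    have hsq : |(p : ℝ) ^ 2 - (k : ℝ) ^ 2| * k ≤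
        ((k + p * b : ℝ) ^ 2 - (p : ℝ) ^ 2) * (k + p * b) := by
      have hy : ((k + p : ℝ) ^ 2 - (p : ℝ) ^ 2) * (k + p) ≤
          ((k + p * b : ℝ) ^ 2 - (p : ℝ) ^ 2) * (k + p * b) := by
        gcongr
        nlinarith
      refine le_trans ?_ hy
      rcases abs_cases ((p : ℝ) ^ 2 - (k : ℝ) ^ 2) with ⟨h1, _⟩ | ⟨h1, _⟩ <;> rw [h1]
      · nlinarith [mul_pos hkR hpR, mul_pos (mul_pos hkR hpR) hpR, mul_pos (mul_pos hkR hkR) hpR,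
          pow_pos hkR 3]
      · nlinarith [mul_pos hkR hpR, mul_pos (mul_pos hkR hpR) hpR, mul_pos (mul_pos hkR hkR) hpR,
          pow_pos hkR 3]
    apply div_le_div_of_nonneg_left (by positivity)
    · have := abs_pos.mpr hne
      positivity
    · nlinarith [mul_le_mul_of_nonneg_left hsq Real.pi_pos.le]

/-- The partial sums telescope, via
`2p / ((y - p) y (y + p)) = 1 / ((y - p) y) - 1 / (y (y + p))` at `y = k + p (a + 1)`. -/
lemma sum_abs_c_le {p k : ℕ} (hk : 0 < k) (hkp : k < p) (n : ℕ) :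
    ∑ a ∈ Finset.range n, |c p (k + p * (a + 1))| ≤
      p * Real.sin (Real.pi * k / p) / (Real.pi * (k * (k + p))) := by
  have hp : 0 < p := by omega
  have hpR : (0 : ℝ) < p := by exact_mod_cast hp
  have hkR : (0 : ℝ) < k := by exact_mod_cast hk
  have hs := sin_pi_mul_div_pos hk hkp
  have hpi := Real.pi_pos
  let U : ℕ → ℝ := fun a =>
    p * Real.sin (Real.pi * k / p) / (Real.pi * ((k + p * a) * (k + p * a + p)))
  have hU : ∀ a, |c p (k + p * (a + 1))| = U a - U (a + 1) := by
    intro a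
    rw [abs_c_add_mul hp hk a.succ_pos, abs_of_pos hs]
    simp only [U]
    have h1 : (0 : ℝ) < k + p * a := by positivity
    have h4 : ((k : ℝ) + p * ((a + 1 : ℕ) : ℝ)) ^ 2 - (p : ℝ) ^ 2 =
        (k + p * a) * (k + p * a + p + p) := by
      push_cast
      ring
    have h5 : (k : ℝ) + p * ((a + 1 : ℕ) : ℝ) = k + p * a + p := by
      push_cast
      ring
    rw [h4, h5]
    generalize (k : ℝ) + p * a = y at *
    field_simp
    ring
  have hn : 0 ≤ U n := by
    simp only [U]
    positivity
  simp only [hU, Finset.sum_range_sub']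
  have h0 : U 0 = p * Real.sin (Real.pi * k / p) / (Real.pi * (k * (k + p))) := by simp [U]
  linarith

lemma telescoped_bound_lt_c {p k : ℕ} (hk : 0 < k) (hkp : k < p) :
    p * Real.sin (Real.pi * k / p) / (Real.pi * (k * (k + p))) < c p k := by
  have hkR : (0 : ℝ) < k := by exact_mod_cast hk
  have hkpR : (k : ℝ) < p := by exact_mod_cast hkp
  have hpR : (0 : ℝ) < p := hkR.trans hkpR
  have hs := sin_pi_mul_div_pos hk hkp
  have hpi := Real.pi_pos
  have hden : 0 < (p : ℝ) - k := by linarith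
  have hfac : (p : ℝ) ^ 2 - (k : ℝ) ^ 2 = (p - k) * (k + p) := by ring
  unfold c
  rw [if_neg hkp.ne, hfac, div_lt_div_iff₀ (by positivity) (by positivity)]
  have hA : 0 < p * Real.sin (Real.pi * k / p) * (Real.pi * (k * (k + p))) := by positivity
  nlinarith [mul_pos hA hkR, mul_pos hA hpR]

lemma F11_pos {p i j : ℕ} (hi : 0 < i) (hip : i < p) (hj : 0 < j) (hjp : j < p) (t : ℝ) :
    0 < F11 p i j t := by
  have h1 := c_pos hi (by omega : i < 2 * p)
  have h2 := d_pos hj hjp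
  have h3 := c_pos (by omega : 0 < i + j) (by omega : i + j < 2 * p)
  unfold F11
  positivity

lemma abs_F11_add_mul_le {p i j b : ℕ} (hi : 0 < i) (hip : i < p) (hj : 0 < j) (hjp : j < p)
    (hb : 0 < b) {t : ℝ} (ht : 0 ≤ t) :
    |F11 p (i + p * b) j t| ≤ |c p (i + p * b)| * (d p j * c p (i + j) *
      Real.exp (-2 * ((i : ℝ) ^ 2 + (j : ℝ) ^ 2 + (i : ℝ) * (j : ℝ)) * t)) := by
  have h2 := d_pos hj hjp
  have h3 := c_pos (by omega : 0 < i + j) (by omega : i + j < 2 * p)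
  have h4 := abs_c_add_mul_le (by omega : 0 < i + j) (by omega : i + j < 2 * p) hb
  have hle : (i : ℝ) ≤ (i + p * b : ℕ) := by exact_mod_cast Nat.le_add_right i (p * b)
  have hexp : Real.exp (-2 * (((i + p * b : ℕ) : ℝ) ^ 2 + (j : ℝ) ^ 2 +
      ((i + p * b : ℕ) : ℝ) * (j : ℝ)) * t) ≤
      Real.exp (-2 * ((i : ℝ) ^ 2 + (j : ℝ) ^ 2 + (i : ℝ) * (j : ℝ)) * t) := by
    have hq : (i : ℝ) ^ 2 + (j : ℝ) ^ 2 + (i : ℝ) * (j : ℝ) ≤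
        ((i + p * b : ℕ) : ℝ) ^ 2 + (j : ℝ) ^ 2 + ((i + p * b : ℕ) : ℝ) * (j : ℝ) := by
      gcongr
    apply Real.exp_le_exp.mpr
    nlinarith [mul_le_mul_of_nonneg_right hq ht]
  unfold F11
  rw [abs_mul, abs_mul, abs_mul, abs_of_pos h2, Real.abs_exp, mul_assoc, mul_assoc,
    show i + p * b + j = i + j + p * b by ring, ← mul_assoc (d p j)]
  gcongr

/-- The first term strictly dominates the rest of the progression `i, i + p, i + 2p, …`. -/
lemma F11_add_tsum_pos {p i j : ℕ} (hi : 0 < i) (hip : i < p) (hj : 0 < j) (hjp : j < p)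
    {t : ℝ} (ht : 0 ≤ t) :
    0 < F11 p i j t + ∑' a : ℕ, F11 p (i + p * (a + 1)) j t := by
  have h2 := d_pos hj hjp
  have h3 := c_pos (by omega : 0 < i + j) (by omega : i + j < 2 * p)
  set E := d p j * c p (i + j) *
    Real.exp (-2 * ((i : ℝ) ^ 2 + (j : ℝ) ^ 2 + (i : ℝ) * (j : ℝ)) * t) with hE
  have hEpos : 0 < E := by positivity
  have hF : F11 p i j t = c p i * E := by
    rw [hE]
    unfold F11
    ring
  have hsum : ∀ n, ∑ a ∈ Finset.range n, |F11 p (i + p * (a + 1)) j t| ≤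
      p * Real.sin (Real.pi * i / p) / (Real.pi * (i * (i + p))) * E := by
    intro n
    calc ∑ a ∈ Finset.range n, |F11 p (i + p * (a + 1)) j t|
        ≤ ∑ a ∈ Finset.range n, |c p (i + p * (a + 1))| * E :=
          Finset.sum_le_sum fun a _ => abs_F11_add_mul_le hi hip hj hjp a.succ_pos ht
      _ = (∑ a ∈ Finset.range n, |c p (i + p * (a + 1))|) * E := by rw [Finset.sum_mul]
      _ ≤ _ := mul_le_mul_of_nonneg_right (sum_abs_c_le hi hip n) hEpos.le
  have hS : Summable fun a : ℕ => |F11 p (i + p * (a + 1)) j t| :=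
    summable_of_sum_range_le (fun _ => abs_nonneg _) hsum
  have hle := Real.tsum_le_of_sum_range_le (fun _ => abs_nonneg _) hsum
  have habs : |∑' a : ℕ, F11 p (i + p * (a + 1)) j t| ≤
      ∑' a : ℕ, |F11 p (i + p * (a + 1)) j t| :=
    norm_tsum_le_tsum_norm (f := fun a : ℕ => F11 p (i + p * (a + 1)) j t) hS
  have hlt := mul_lt_mul_of_pos_right (telescoped_bound_lt_c hi hip) hEpos
  have hneg := neg_abs_le (∑' a : ℕ, F11 p (i + p * (a + 1)) j t)
  rw [hF]
  linarith only [hle, habs, hlt, hneg]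

theorem J11_remaining_pos (p : ℕ) (hp : 3 ≤ p) (t : ℝ) (ht : 0 ≤ t) :
    0 < ∑ m ∈ Finset.Ico 1 p, ∑ l ∈ Finset.Ico 1 p,
        (F11 p (p - m) (p - l) t + ∑' a : ℕ, F11 p (p * (a + 2) - m) (p - l) t) := by
  have hne : (Finset.Ico 1 p).Nonempty := Finset.nonempty_Ico.mpr (by omega)
  refine Finset.sum_pos (fun m hm => Finset.sum_pos (fun l hl => ?_) hne) hne
  rw [Finset.mem_Ico] at hm hl
  have hshift : ∀ a : ℕ, p * (a + 2) - m = p - m + p * (a + 1) := by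
    intro a
    have : p * (a + 2) = p + p * (a + 1) := by ring
    omega
  simp only [hshift]
  exact F11_add_tsum_pos (by omega) (by omega) (by omega) (by omega) ht
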